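/- There exists a self-dual binary linear code C ⊆ F₂^{72} whose minimum nonzero Hamming weight is 12, which contains exactly 906 codewords of Hamming weight 12 and exactly 7488 codewords of Hamming weight 14 (the weight enumerator W_{72,1} with γ = 18 and β = 453). -/

import Mathlib

/-- A subspace `C` of `(ZMod 2)^ι` is self-dual if it equals its Euclidean dual. -/
def IsSelfDual {R : Type*} [CommRing R] {ι : Type*} [Fintype ι]
    (C : Submodule R (ι → R)) : Prop :=
  ∀ x, x ∈ C ↔ ∀ y ∈ C, ∑ i, x i * y i = 0

/-- The Hamming weight of a vector: the number of nonzero coordinates. -/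
def hamWt {ι : Type*} [Fintype ι] {R : Type*} [Zero R] [DecidableEq R] (v : ι → R) : ℕ :=
  (Finset.univ.filter fun i => v i ≠ 0).card

/-- The number of ones among the lowest `2 ^ d` binary digits of a number. -/
def popCount : ℕ → ℕ → ℕ
  | 0, x => x
  | d + 1, x =>
    bif x.beq 0 then 0 else popCount d (x &&& (2 ^ 2 ^ d - 1)) + popCount d (x >>> 2 ^ d)

/-- Numbers `s₀, s₁, …` encode at each bit position a binary counter, with digits from the lowest.
This adds the bits of `c` to all counters at once, dropping overflows. -/
def addSlices : List ℕ → ℕ → List ℕ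
  | [], _ => []
  | s :: t, c => (s ^^^ c) :: addSlices t (s &&& c)

/-- The bit positions, within `full`, at which the counter equals `j`. -/
def eqMask (full : ℕ) : List ℕ → ℕ → ℕ
  | [], _ => full
  | s :: t, j => (bif j.testBit 0 then s else s ^^^ full) &&& eqMask full t (j / 2)

/-- One step of the recursion for a row of bits, each standing for the value of an additive
Boolean function at an element of a list: from the pairs (length, packed values) for the subset
sums of sizes `k, k + 1, …` compute those for the sizes `k + 1, …` after adding an element on which
the function takes the value `b`. -/
def nextPacked (b : Bool) : ℕ × ℕ → List (ℕ × ℕ) → List (ℕ × ℕ)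
  | _, [] => []
  | p, q :: t =>
    (q.1 + p.1, q.2 + (bif b then p.2 ^^^ (2 ^ p.1 - 1) else p.2) <<< q.1) :: nextPacked b q t

/-- The number of `k`-element subsets of the given list of bits, together with the packed list of
their sums modulo two. -/
def packedColumn (k : ℕ) (bits : List Bool) : ℕ × ℕ :=
  ((1, 0) :: bits.foldr (fun b T => nextPacked b (1, 0) T) (List.replicate k (0, 0))).getD k (0, 0)

/-- Bit-sliced counters modulo `2 ^ 6` of the ones at each bit position of the given numbers. -/
def weightSlices (cols : List ℕ) : List ℕ :=
  cols.foldl addSlices (List.replicate 6 0)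

/-- For each `j` in `js`, the number of sums of `k` rows of a binary matrix that have weight `j`,
computed on all sums of `k` rows simultaneously. -/
def sliceCounts {m n : ℕ} (e : Fin m → Fin n → Bool) (k : ℕ) (js : List ℕ) : List ℕ :=
  let full := 2 ^ (packedColumn k ((List.finRange m).map fun _ => false)).1 - 1
  let slices := weightSlices ((List.finRange n).map fun c =>
    (packedColumn k ((List.finRange m).map fun r => e r c)).2)
  js.map fun j => popCount 23 (eqMask full slices j)

section Packing

variable {α β : Type*}

/-- The number whose binary digits, starting with the lowest, are the values of `f` along `l`. -/
def packBits (f : α → Bool) (l : List α) : ℕ :=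
  l.foldr (fun a n => Nat.bit (f a) n) 0

@[simp] theorem packBits_nil (f : α → Bool) : packBits f [] = 0 := rfl

@[simp] theorem packBits_cons (f : α → Bool) (a : α) (l : List α) :
    packBits f (a :: l) = Nat.bit (f a) (packBits f l) := rfl

theorem packBits_congr {f g : α → Bool} (h : ∀ a, f a = g a) (l : List α) :
    packBits f l = packBits g l := by
  rw [funext h]

theorem packBits_lt (f : α → Bool) (l : List α) : packBits f l < 2 ^ l.length := by
  induction l with
  | nil => simp
  | cons a l ih =>
    rw [packBits_cons, List.length_cons, pow_succ, Nat.bit_val]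
    have := Bool.toNat_le (f a)
    omega

theorem packBits_append (f : α → Bool) (l₁ l₂ : List α) :
    packBits f (l₁ ++ l₂) = packBits f l₁ + packBits f l₂ <<< l₁.length := by
  induction l₁ with
  | nil => simp
  | cons a l ih =>
    simp only [List.cons_append, packBits_cons, ih, Nat.bit_val, List.length_cons,
      Nat.shiftLeft_eq, pow_succ]
    ring

theorem packBits_map (f : β → Bool) (g : α → β) (l : List α) :
    packBits f (l.map g) = packBits (fun a => f (g a)) l := by
  simp [packBits, List.foldr_map]

theorem packBits_xor (f g : α → Bool) (l : List α) :
    packBits (fun a => f a ^^ g a) l = packBits f l ^^^ packBits g l := by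
  induction l with
  | nil => simp
  | cons a l ih => simp only [packBits_cons, ih, Nat.xor_bit]

theorem packBits_and (f g : α → Bool) (l : List α) :
    packBits (fun a => f a && g a) l = packBits f l &&& packBits g l := by
  induction l with
  | nil => simp
  | cons a l ih => simp only [packBits_cons, ih, Nat.land_bit]

theorem packBits_true (l : List α) : packBits (fun _ => true) l = 2 ^ l.length - 1 := by
  induction l with
  | nil => simp
  | cons a l ih =>
    have := Nat.one_le_two_pow (n := l.length)
    rw [packBits_cons, ih, List.length_cons, pow_succ, Nat.bit_val, Bool.toNat_true]
    omega

theorem packBits_false (l : List α) : packBits (fun _ => false) l = 0 := by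
  induction l with
  | nil => simp
  | cons a l ih => simp [ih, Nat.bit_val]

theorem packBits_not (f : α → Bool) (l : List α) :
    packBits (fun a => !f a) l = packBits f l ^^^ (2 ^ l.length - 1) := by
  rw [← packBits_true, ← packBits_xor]
  simp

theorem popCount_packBits (f : α → Bool) (d : ℕ) (l : List α) (hl : l.length ≤ 2 ^ d) :
    popCount d (packBits f l) = l.countP f := by
  induction d generalizing l with
  | zero =>
    match l, hl with
    | [], _ => rfl
    | [a], _ => cases h : f a <;> simp [popCount, h]
  | succ d ih =>
    by_cases h0 : packBits f l = 0
    · have : ∀ a ∈ l, f a = false := by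
        clear hl ih
        induction l with
        | nil => simp
        | cons a l ih =>
          simp only [packBits_cons, Nat.bit_eq_zero_iff] at h0
          simpa [h0.2] using ih h0.1
      rw [popCount, h0, List.countP_eq_zero.2 (by simpa using this)]
      rfl
    · have hpos : (packBits f l).beq 0 = false := by
        rwa [← Bool.not_eq_true, Nat.beq_eq]
      rw [pow_succ] at hl
      have hlow : packBits f l &&& (2 ^ 2 ^ d - 1) = packBits f (l.take (2 ^ d)) ∧
          packBits f l >>> 2 ^ d = packBits f (l.drop (2 ^ d)) := by
        rw [Nat.and_two_pow_sub_one_eq_mod, Nat.shiftRight_eq_div_pow]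
        rcases le_total l.length (2 ^ d) with h | h
        · have hlt := (packBits_lt f l).trans_le (Nat.pow_le_pow_right two_pos h)
          rw [Nat.mod_eq_of_lt hlt, Nat.div_eq_of_lt hlt, List.take_of_length_le h,
            List.drop_of_length_le h]
          simp
        · have hlen : (l.take (2 ^ d)).length = 2 ^ d := by simpa using h
          have hlt := packBits_lt f (l.take (2 ^ d))
          have happ := packBits_append f (l.take (2 ^ d)) (l.drop (2 ^ d))
          rw [List.take_append_drop, Nat.shiftLeft_eq, mul_comm] at happ
          rw [hlen] at hlt happ
          rw [happ, Nat.add_mul_mod_self_left, Nat.mod_eq_of_lt hlt,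
            Nat.add_mul_div_left _ _ (by positivity), Nat.div_eq_of_lt hlt, zero_add]
          exact ⟨rfl, rfl⟩
      rw [popCount, hpos, cond_false, hlow.1, hlow.2, ih _ (by simp), ih _ (by simp; omega),
        ← List.countP_append, List.take_append_drop]

theorem exists_addSlices_eq (l : List α) (gs : List (α → Bool)) (f : α → Bool) :
    ∃ gs' : List (α → Bool),
      addSlices (gs.map (packBits · l)) (packBits f l) = gs'.map (packBits · l) ∧
      gs'.length = gs.length ∧
      ∀ a, packBits (· a) gs' ≡ packBits (· a) gs + (f a).toNat [MOD 2 ^ gs.length] := by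
  induction gs generalizing f with
  | nil => exact ⟨[], rfl, rfl, fun a => by simp [Nat.modEq_one]⟩
  | cons g gs ih =>
    obtain ⟨gs', h, hlen, hval⟩ := ih fun a => g a && f a
    refine ⟨(fun a => g a ^^ f a) :: gs', ?_, by simp [hlen], fun a => ?_⟩
    · simp only [List.map_cons, addSlices, packBits_xor, ← packBits_and, h]
    · have := (hval a).mul_left' 2
      rw [List.length_cons, pow_succ, mul_comm (2 ^ gs.length)]
      simp only [packBits_cons, Nat.bit_val]
      have key : 2 * (packBits (· a) gs + (g a && f a).toNat) + (g a ^^ f a).toNat =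
          2 * packBits (· a) gs + (g a).toNat + (f a).toNat := by
        cases g a <;> cases f a <;> simp; ring
      rw [← key]
      exact this.add_right _

theorem exists_weightSlices_eq (l : List α) (fs : List (α → Bool)) :
    ∃ gs : List (α → Bool),
      weightSlices (fs.map (packBits · l)) = gs.map (packBits · l) ∧ gs.length = 6 ∧
      ∀ a, packBits (· a) gs ≡ fs.countP (· a) [MOD 2 ^ 6] := by
  suffices H : ∀ gs₀ : List (α → Bool), ∃ gs : List (α → Bool),
      (fs.map (packBits · l)).foldl addSlices (gs₀.map (packBits · l)) =
        gs.map (packBits · l) ∧ gs.length = gs₀.length ∧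
      ∀ a, packBits (· a) gs ≡ packBits (· a) gs₀ + fs.countP (· a) [MOD 2 ^ gs₀.length] by
    have h0 := H (List.replicate 6 fun _ => false)
    have hz : ∀ a : α, packBits (fun g : α → Bool => g a)
        (List.replicate 6 fun _ => false) = 0 := fun a => by simp [List.replicate]
    simpa [weightSlices, packBits_false, hz] using h0
  induction fs with
  | nil => exact fun gs₀ => ⟨gs₀, rfl, rfl, fun a => by simp [Nat.ModEq]⟩
  | cons f fs ih =>
    intro gs₀
    obtain ⟨gs₁, h₁, hlen₁, hval₁⟩ := exists_addSlices_eq l gs₀ f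
    obtain ⟨gs₂, h₂, hlen₂, hval₂⟩ := ih gs₁
    refine ⟨gs₂, by simpa [h₁] using h₂, hlen₂.trans hlen₁, fun a => ?_⟩
    have h := hval₂ a
    rw [hlen₁] at h
    refine h.trans (((hval₁ a).add_right _).trans ?_)
    rw [List.countP_cons, add_assoc, add_comm (f a).toNat]
    cases f a <;> simp [Nat.ModEq]

theorem eqMask_map_packBits (l : List α) (gs : List (α → Bool)) (j : ℕ)
    (hj : j < 2 ^ gs.length) :
    eqMask (2 ^ l.length - 1) (gs.map (packBits · l)) j =
      packBits (fun a => decide (packBits (· a) gs = j)) l := by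
  induction gs generalizing j with
  | nil =>
    obtain rfl : j = 0 := by simpa using hj
    simp [eqMask, packBits_true]
  | cons g gs ih =>
    rw [List.length_cons, pow_succ] at hj
    have hbit : ∀ a, decide (packBits (· a) (g :: gs) = j) =
        ((bif j.testBit 0 then g a else !g a) && decide (packBits (· a) gs = j / 2)) := by
      intro a
      rw [packBits_cons, Nat.bit_val, Nat.testBit_zero]
      have h2 := Nat.mod_two_eq_zero_or_one j
      rcases h2 with h2 | h2 <;> cases g a <;> simp [h2] <;> omega
    rw [packBits_congr hbit, packBits_and, ← ih (j / 2) (by omega), List.map_cons, eqMask]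
    congr 1
    cases j.testBit 0 <;> simp [packBits_not]

end Packing

section SubsetSums

variable {V : Type*} [AddCommMonoid V]

/-- The sums of the `k`-element sublists of a list. -/
def subsetSums : List V → ℕ → List V
  | _, 0 => [0]
  | [], _ + 1 => []
  | r :: rs, k + 1 => subsetSums rs (k + 1) ++ (subsetSums rs k).map (r + ·)

@[simp] theorem subsetSums_zero (rs : List V) : subsetSums rs 0 = [0] := by
  cases rs <;> rfl

theorem length_subsetSums (rs : List V) (k : ℕ) :
    (subsetSums rs k).length = rs.length.choose k := by
  induction rs generalizing k with
  | nil => cases k <;> simp [subsetSums]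
  | cons r rs ih => cases k <;> simp [subsetSums, ih, Nat.choose_succ_succ, add_comm]

theorem nextPacked_map_subsetSums (f : V → Bool) (hf : ∀ v w, f (v + w) = (f v ^^ f w))
    (r : V) (rs : List V) (m k : ℕ) :
    nextPacked (f r) ((subsetSums rs k).length, packBits f (subsetSums rs k))
        ((List.range' (k + 1) m).map fun i =>
          ((subsetSums rs i).length, packBits f (subsetSums rs i))) =
      (List.range' (k + 1) m).map fun i =>
        ((subsetSums (r :: rs) i).length, packBits f (subsetSums (r :: rs) i)) := by
  induction m generalizing k with
  | zero => rfl
  | succ m ih =>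
    rw [List.range'_succ, List.map_cons, nextPacked, ih, List.map_cons]
    congr 2
    · simp [subsetSums]
    · rw [subsetSums, packBits_append, packBits_map, packBits_congr (hf r)]
      cases f r
      · simp
      · simp [packBits_not]

theorem packedColumn_map (f : V → Bool) (h0 : f 0 = false)
    (hf : ∀ v w, f (v + w) = (f v ^^ f w)) (rs : List V) (k : ℕ) :
    packedColumn k (rs.map f) = ((subsetSums rs k).length, packBits f (subsetSums rs k)) := by
  have H : (rs.map f).foldr (fun b T => nextPacked b (1, 0) T) (List.replicate k (0, 0)) =
      (List.range' 1 k).map fun i =>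
        ((subsetSums rs i).length, packBits f (subsetSums rs i)) := by
    induction rs with
    | nil =>
      refine (List.eq_replicate_iff.2 ⟨by simp, fun p hp => ?_⟩).symm
      obtain ⟨i, hi, rfl⟩ := List.mem_map.1 hp
      obtain ⟨i, rfl⟩ := Nat.exists_eq_succ_of_ne_zero (n := i) (by simp at hi; omega)
      rfl
    | cons r rs ih =>
      rw [List.map_cons, List.foldr_cons, ih, ← nextPacked_map_subsetSums f hf r rs k 0]
      simp [h0, Nat.bit_val]
  have h1 : ((1, 0) : ℕ × ℕ) = ((subsetSums rs 0).length, packBits f (subsetSums rs 0)) := by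
    simp [h0, Nat.bit_val]
  rw [packedColumn, H, h1, List.range'_eq_map_range, List.map_map]
  cases k with
  | zero => rfl
  | succ k => simp [add_comm]

theorem hamWt_eq_sum {ι R : Type*} [Fintype ι] [Zero R] [DecidableEq R] (v : ι → R) :
    hamWt v = ∑ i, if v i ≠ 0 then 1 else 0 :=
  Finset.card_filter _ _

theorem hamWt_cons {n : ℕ} {R : Type*} [Zero R] [DecidableEq R] (a : R) (v : Fin n → R) :
    hamWt (Fin.cons a v : Fin (n + 1) → R) = hamWt v + if a ≠ 0 then 1 else 0 := by
  simp only [hamWt_eq_sum, Fin.sum_univ_succ, Fin.cons_zero, Fin.cons_succ, add_comm]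

theorem countP_subsetSums_ofFn {W : Type*} [AddCommGroup W] [Module (ZMod 2) W] {n : ℕ}
    (rows : Fin n → W) (k : ℕ) (p : W → Bool) :
    (subsetSums (List.ofFn rows) k).countP p =
      (Finset.univ.filter fun x : Fin n → ZMod 2 =>
        hamWt x = k ∧ p (∑ i, x i • rows i) = true).card := by
  induction n generalizing k p with
  | zero =>
    have hx : ∀ x : Fin 0 → ZMod 2, hamWt x = 0 := fun x => by simp [hamWt]
    cases k with
    | zero => cases h : p 0 <;> simp [hx, h]
    | succ k => simp [subsetSums, hx]
  | succ n ih =>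
    have hsplit : ∀ q : (Fin (n + 1) → ZMod 2) → ℕ,
        ∑ x, q x = ∑ x, q (Fin.cons 0 x) + ∑ x, q (Fin.cons 1 x) := fun q => by
      rw [← (Fin.consEquiv fun _ => ZMod 2).sum_comp, Fintype.sum_prod_type]
      exact Fin.sum_univ_two (M := ℕ) _
    rw [Finset.card_filter, hsplit]
    simp only [hamWt_cons, Fin.sum_univ_succ, Fin.cons_zero, Fin.cons_succ, zero_smul, zero_add,
      one_smul, ne_eq, not_true_eq_false, one_ne_zero, not_false_eq_true, if_true, if_false,
      add_zero, ← Finset.card_filter]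
    rw [← ih (fun i => rows i.succ) k p]
    cases k with
    | zero => simp
    | succ k =>
      rw [List.ofFn_succ, subsetSums, List.countP_append, List.countP_map]
      congr 1
      simpa using ih (fun i => rows i.succ) k (p ∘ (rows 0 + ·))

end SubsetSums

section Matrix

/-- The binary matrix with the given positions of ones. -/
def boolMatrix {m n : ℕ} (e : Fin m → Fin n → Bool) : Matrix (Fin m) (Fin n) (ZMod 2) :=
  Matrix.of fun r c => if e r c then 1 else 0

/-- The number of vectors of weight `i` whose image under `x ↦ x ᵥ* M` has weight `j`. -/
def weightCount {m n : ℕ} (M : Matrix (Fin m) (Fin n) (ZMod 2)) (i j : ℕ) : ℕ :=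
  (Finset.univ.filter fun x : Fin m → ZMod 2 =>
    hamWt x = i ∧ hamWt (Matrix.vecMul x M) = j).card

theorem sliceCounts_eq {m n : ℕ} (e : Fin m → Fin n → Bool) (k : ℕ) (js : List ℕ)
    (hk : m.choose k ≤ 2 ^ 23) (hn : n < 64) (hjs : ∀ j ∈ js, j < 64) :
    sliceCounts e k js = js.map (weightCount (boolMatrix e) k) := by
  set rs : List (Fin n → ZMod 2) := List.ofFn (boolMatrix e).row with hrs
  let f : Fin n → (Fin n → ZMod 2) → Bool := fun c v => decide (v c ≠ 0)
  have hcol : ∀ c, (List.finRange m).map (fun r => e r c) = rs.map (f c) := by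
    intro c
    rw [hrs, List.ofFn_eq_map, List.map_map]
    refine List.map_congr_left fun r _ => ?_
    change e r c = decide (boolMatrix e r c ≠ 0)
    cases h : e r c <;> simp [boolMatrix, h]
  have hadd : ∀ a b : ZMod 2, decide (a + b ≠ 0) = (decide (a ≠ 0) ^^ decide (b ≠ 0)) := by
    decide
  have hcols : ∀ c, packedColumn k ((List.finRange m).map fun r => e r c) =
      ((subsetSums rs k).length, packBits (f c) (subsetSums rs k)) := fun c => by
    rw [hcol, packedColumn_map _ (by simp [f]) (fun v w => hadd _ _)]
  have hfull : packedColumn k ((List.finRange m).map fun _ => false) =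
      ((subsetSums rs k).length, packBits (fun _ => false) (subsetSums rs k)) := by
    rw [← packedColumn_map (fun _ => false) rfl (fun _ _ => rfl), hrs, List.ofFn_eq_map,
      List.map_map]
    rfl
  obtain ⟨gs, hgs, hlen, hval⟩ :=
    exists_weightSlices_eq (subsetSums rs k) ((List.finRange n).map f)
  have hwt : ∀ v, packBits (· v) gs = hamWt v := by
    intro v
    have hcount : ((List.finRange n).map f).countP (· v) = hamWt v := by
      rw [List.countP_map, hamWt, Finset.card_def, Finset.filter_val, ← Multiset.countP_eq_card_filter]
      rfl
    have h1 := packBits_lt (· v) gs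
    have h2 : hamWt v ≤ n := (Finset.card_le_univ _).trans_eq (Fintype.card_fin n)
    have h3 := hval v
    rw [hlen] at h1
    rw [hcount] at h3
    exact h3.eq_of_lt_of_lt h1 (by omega)
  rw [List.map_map] at hgs
  simp only [sliceCounts, hcols, hfull]
  refine List.map_congr_left fun j hj => ?_
  change popCount 23 (eqMask _ (weightSlices ((List.finRange n).map
    ((fun g => packBits g (subsetSums rs k)) ∘ f))) j) = _
  rw [hgs, eqMask_map_packBits _ _ _ (by rw [hlen]; exact hjs j hj),
    popCount_packBits _ _ _ (by rw [length_subsetSums, hrs, List.length_ofFn]; exact hk),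
    hrs, countP_subsetSums_ofFn]
  simp only [hwt, decide_eq_true_eq, weightCount, Matrix.vecMul_eq_sum]
  rfl

end Matrix

section DoubledCode

variable {n : ℕ}

/-- The code consisting of the concatenations of `x` and `x ᵥ* M`. -/
def doubledCode (M : Matrix (Fin n) (Fin n) (ZMod 2)) :
    Submodule (ZMod 2) (Fin (n + n) → ZMod 2) :=
  LinearMap.range (
    { toFun := fun x => Fin.append x (Matrix.vecMul x M)
      map_add' := fun x y => by
        ext i
        refine Fin.addCases (fun i => ?_) (fun i => ?_) i <;>
          simp only [Fin.append_left, Fin.append_right, Matrix.add_vecMul, Pi.add_apply]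
      map_smul' := fun c x => by
        ext i
        refine Fin.addCases (fun i => ?_) (fun i => ?_) i <;>
          simp only [Fin.append_left, Fin.append_right, Matrix.smul_vecMul, Pi.smul_apply,
            RingHom.id_apply] } : (Fin n → ZMod 2) →ₗ[ZMod 2] Fin (n + n) → ZMod 2)

theorem mem_doubledCode {M : Matrix (Fin n) (Fin n) (ZMod 2)} {v : Fin (n + n) → ZMod 2} :
    v ∈ doubledCode M ↔ ∃ x, Fin.append x (Matrix.vecMul x M) = v :=
  LinearMap.mem_range

theorem sum_append_mul_append (a b c d : Fin n → ZMod 2) :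
    ∑ i, Fin.append a b i * Fin.append c d i = a ⬝ᵥ c + b ⬝ᵥ d := by
  simp only [Fin.sum_univ_add, Fin.append_left, Fin.append_right, dotProduct]

theorem hamWt_append (a b : Fin n → ZMod 2) : hamWt (Fin.append a b) = hamWt a + hamWt b := by
  simp only [hamWt_eq_sum, Fin.sum_univ_add, Fin.append_left, Fin.append_right]

theorem isSelfDual_doubledCode {M : Matrix (Fin n) (Fin n) (ZMod 2)}
    (hM : M * M.transpose = 1) : IsSelfDual (doubledCode M) := by
  have hM' : M.transpose * M = 1 := mul_eq_one_comm.1 hM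
  intro v
  constructor
  · intro hv w hw
    obtain ⟨x, rfl⟩ := mem_doubledCode.1 hv
    obtain ⟨y, rfl⟩ := mem_doubledCode.1 hw
    refine (sum_append_mul_append x _ y _).trans ?_
    rw [← Matrix.mulVec_transpose M y, Matrix.dotProduct_mulVec, Matrix.vecMul_vecMul, hM,
      Matrix.vecMul_one, CharTwo.add_self_eq_zero]
  · intro h
    obtain ⟨a, b, rfl⟩ : ∃ a b, v = Fin.append a b :=
      ⟨_, _, (Fin.append_castAdd_natAdd (f := v)).symm⟩
    have hab : a = M.mulVec b := by
      ext i
      have hi := h _ (mem_doubledCode.2 ⟨Pi.single i 1, rfl⟩)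
      rw [sum_append_mul_append, dotProduct_single, mul_one, Matrix.single_one_vecMul,
        dotProduct_comm, CharTwo.add_eq_zero] at hi
      exact hi
    refine mem_doubledCode.2 ⟨a, ?_⟩
    rw [hab, ← Matrix.vecMul_transpose, Matrix.vecMul_vecMul, hM', Matrix.vecMul_one]

theorem weightCount_transpose {M : Matrix (Fin n) (Fin n) (ZMod 2)}
    (hM : M * M.transpose = 1) (i j : ℕ) :
    weightCount M.transpose j i = weightCount M i j := by
  have hM' : M.transpose * M = 1 := mul_eq_one_comm.1 hM
  have h : ∀ x, Matrix.vecMul (Matrix.vecMul x M) M.transpose = x := fun x => by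
    rw [Matrix.vecMul_vecMul, hM, Matrix.vecMul_one]
  have h' : ∀ x, Matrix.vecMul (Matrix.vecMul x M.transpose) M = x := fun x => by
    rw [Matrix.vecMul_vecMul, hM', Matrix.vecMul_one]
  refine Finset.card_bij' (fun x _ => Matrix.vecMul x M.transpose)
    (fun x _ => Matrix.vecMul x M) ?_ ?_ (fun x _ => h' x) (fun x _ => h x)
  · intro x hx
    simpa [h', and_comm] using hx
  · intro x hx
    simpa [h, and_comm] using hx

theorem card_hamWt_doubledCode (M : Matrix (Fin n) (Fin n) (ZMod 2)) (w : ℕ) :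
    Nat.card {v : Fin (n + n) → ZMod 2 // v ∈ doubledCode M ∧ hamWt v = w} =
      ∑ ij ∈ Finset.HasAntidiagonal.antidiagonal w, weightCount M ij.1 ij.2 := by
  have hinj : Function.Injective fun x : Fin n → ZMod 2 => Fin.append x (Matrix.vecMul x M) :=
    fun x y hxy => funext fun i => by
      simpa using congr_fun hxy (Fin.castAdd n i)
  have himage : {v : Fin (n + n) → ZMod 2 | v ∈ doubledCode M ∧ hamWt v = w} =
      (fun x : Fin n → ZMod 2 => Fin.append x (Matrix.vecMul x M)) ''
        {x | hamWt x + hamWt (Matrix.vecMul x M) = w} := by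
    ext v
    simp only [mem_doubledCode, Set.mem_ofPred_eq, Set.mem_image]
    constructor
    · rintro ⟨⟨x, rfl⟩, hw⟩
      exact ⟨x, by rwa [hamWt_append] at hw, rfl⟩
    · rintro ⟨x, hw, rfl⟩
      exact ⟨⟨x, rfl⟩, by rwa [hamWt_append]⟩
  change Nat.card {v : Fin (n + n) → ZMod 2 | v ∈ doubledCode M ∧ hamWt v = w} = _
  rw [himage, Nat.card_image_of_injective hinj, Nat.card_eq_card_toFinset,
    Finset.card_eq_sum_card_fiberwise
      (f := fun x => (hamWt x, hamWt (Matrix.vecMul x M))) (t := Finset.HasAntidiagonal.antidiagonal w)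
      (fun x hx => by simpa using hx)]
  refine Finset.sum_congr rfl fun ij hij => ?_
  rw [Finset.HasAntidiagonal.mem_antidiagonal] at hij
  refine congr_arg Finset.card (Finset.ext fun x => ?_)
  simp only [Set.mem_toFinset, Set.mem_ofPred_eq, Finset.mem_filter, Finset.mem_univ, true_and,
    Prod.ext_iff]
  omega

end DoubledCode

section CirculantCode

/-- The entries of a matrix built from four circulant blocks of order 18; the blocks are
`A`, `B` in the first row and `Bᵀ`, `Aᵀ` in the second. -/
def fourCirculantEntry (i j : Fin 36) : Bool :=
  (bif (i.val.blt 18) == (j.val.blt 18) then 10455 else 9977).testBit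
    ((bif i.val.blt 18 then j.val + 36 - i.val else i.val + 36 - j.val) % 18)

theorem fourCirculant_mul_transpose :
    boolMatrix fourCirculantEntry * (boolMatrix fourCirculantEntry).transpose = 1 := by
  have h : ∀ i j, (List.finRange 36).countP
      (fun k => fourCirculantEntry i k && fourCirculantEntry j k) % 2 =
        if i = j then 1 else 0 := by
    decide +kernel
  ext i j
  have hcount : (boolMatrix fourCirculantEntry * (boolMatrix fourCirculantEntry).transpose) i j =
      ((List.finRange 36).countP
        (fun k => fourCirculantEntry i k && fourCirculantEntry j k) : ℕ) := by
    have hcard : (List.finRange 36).countP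
        (fun k => fourCirculantEntry i k && fourCirculantEntry j k) =
          (Finset.univ.filter fun k =>
            (fourCirculantEntry i k && fourCirculantEntry j k) = true).card := by
      rw [Finset.card_def, Finset.filter_val, ← Multiset.countP_eq_card_filter]
      exact ((Multiset.coe_countP _ (List.finRange 36)).trans
        (by simp only [Bool.decide_eq_true])).symm
    rw [hcard, Matrix.mul_apply, Finset.card_filter, Nat.cast_sum]
    refine Finset.sum_congr rfl fun k _ => ?_
    cases hi : fourCirculantEntry i k <;> cases hj : fourCirculantEntry j k <;>
      simp [boolMatrix, hi, hj]
  rw [hcount, ← ZMod.natCast_mod, h, Matrix.one_apply]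
  by_cases hij : i = j <;> simp [hij]

/-- The number of codewords of weight at most 14 whose two halves have weights `i` and `j`. -/
def halfWeightCount : ℕ → ℕ → ℕ
  | 0, 0 => 1
  | 2, 10 => 18
  | 3, 11 => 144
  | 4, 8 => 288
  | 5, 9 => 1944
  | 6, 6 => 330
  | 7, 7 => 3096
  | 8, 4 => 252
  | 9, 5 => 2160
  | 10, 2 => 18
  | 11, 3 => 144
  | _, _ => 0

theorem weightCount_boolMatrix_eq {e : Fin 36 → Fin 36 → Bool} {f : ℕ → ℕ}
    {i j : ℕ} (hi : i < 8) (hij : i + j ≤ 14)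
    (h : sliceCounts e i (List.range (15 - i)) = (List.range (15 - i)).map f) :
    weightCount (boolMatrix e) i j = f j := by
  have hchoose : ∀ i < 8, Nat.choose 36 i ≤ 2 ^ 23 := by decide
  rw [sliceCounts_eq e i _ (hchoose i hi) (by decide)
    fun j hj => (List.mem_range.1 hj).trans (by omega)] at h
  exact List.map_inj_left.1 h j (List.mem_range.2 (by omega))

theorem weightCount_fourCirculant {i j : ℕ} (hij : i + j ≤ 14) :
    weightCount (boolMatrix fourCirculantEntry) i j = halfWeightCount i j := by
  have hleft : ∀ i < 8, sliceCounts fourCirculantEntry i (List.range (15 - i)) =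
      (List.range (15 - i)).map (halfWeightCount i) := by
    decide +kernel
  have hright : ∀ j < 7, sliceCounts (fun r c => fourCirculantEntry c r) j
      (List.range (15 - j)) = (List.range (15 - j)).map (halfWeightCount · j) := by
    decide +kernel
  rcases Nat.lt_or_ge i 8 with hi | hi
  · exact weightCount_boolMatrix_eq hi hij (hleft i hi)
  · rw [← weightCount_transpose fourCirculant_mul_transpose]
    exact weightCount_boolMatrix_eq (f := (halfWeightCount · j))
      (by omega) (by omega) (hright j (by omega))

theorem card_hamWt_fourCirculant {w : ℕ} (hw : w ≤ 14) :
    Nat.card {v : Fin (36 + 36) → ZMod 2 //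
        v ∈ doubledCode (boolMatrix fourCirculantEntry) ∧ hamWt v = w} =
      ∑ ij ∈ Finset.HasAntidiagonal.antidiagonal w, halfWeightCount ij.1 ij.2 := by
  rw [card_hamWt_doubledCode]
  refine Finset.sum_congr rfl fun ij hij => weightCount_fourCirculant ?_
  rwa [Finset.HasAntidiagonal.mem_antidiagonal.1 hij]

end CirculantCode

/-- There is a self-dual binary linear code of length 72 with minimum nonzero Hamming
weight 12, having exactly 906 codewords of weight 12 and exactly 7488 codewords of
weight 14 (weight enumerator `W_{72,1}` with γ = 18 and β = 453). -/
theorem exists_selfDual_code_72_gamma_18_beta_453 :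
    ∃ C : Submodule (ZMod 2) (Fin 72 → ZMod 2),
      IsSelfDual C ∧
      IsLeast {k | ∃ v ∈ C, v ≠ 0 ∧ hamWt v = k} 12 ∧
      Nat.card {v : Fin 72 → ZMod 2 // v ∈ C ∧ hamWt v = 12} = 906 ∧
      Nat.card {v : Fin 72 → ZMod 2 // v ∈ C ∧ hamWt v = 14} = 7488 := by
  have h12 := card_hamWt_fourCirculant (w := 12) (by decide)
  have h14 := card_hamWt_fourCirculant (w := 14) (by decide)
  refine ⟨doubledCode (boolMatrix fourCirculantEntry),
    isSelfDual_doubledCode fourCirculant_mul_transpose, ⟨?_, ?_⟩, h12, h14⟩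
  · obtain ⟨v, hv, hw⟩ := (Nat.card_pos_iff.1 (Nat.pos_of_ne_zero (h12.trans_ne (by decide)))).1
    refine ⟨v, hv, ?_, hw⟩
    rintro rfl
    simp [hamWt] at hw
  · rintro w ⟨v, hv, hv0, rfl⟩
    by_contra! hlt
    have hzero : ∀ w < 12, w ≠ 0 →
        ∑ ij ∈ Finset.HasAntidiagonal.antidiagonal w, halfWeightCount ij.1 ij.2 = 0 := by
      decide
    have hpos : hamWt v ≠ 0 := fun h => hv0 <| funext fun i => by
      simpa using Finset.filter_eq_empty_iff.1 (Finset.card_eq_zero.1 h) (Finset.mem_univ i)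
    have hcard := (card_hamWt_fourCirculant (hlt.le.trans (by decide))).trans (hzero _ hlt hpos)
    exact (Finite.card_eq_zero_iff.1 hcard).false ⟨v, hv, rfl⟩
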